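/- Let e''=(x',y) be an edge of T_X such that φ_y(g_{x'},g'_{x'}) < φ_y(g_y,g'_y), and suppose additionally that {a_{x'}, a'_{x'}} ∩ U(e'',x') ≠ ∅. Then a_y, a'_y ∈ U(e'',x') and {a_{x'}, a'_{x'}} ∩ U(e'',y) ≠ ∅. -/

import Mathlib

open SimpleGraph

variable {V : Type*} [Fintype V] [DecidableEq V]

/-- The vertex set of the connected component of `w` in the graph obtained from `T` by
removing the edge `s(u, v)`. -/
def sideOf (T : SimpleGraph V) (u v w : V) : Set V :=
  {t | (T.deleteEdges {s(u, v)}).Reachable w t}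

/-- The swap edges of the tree edge `(u, v)`: all edges of `G` other than `s(u, v)` whose
first endpoint lies in the component `X` of `u` and whose second endpoint lies in the
component `Y` of `v` of `T - e`. -/
def swapSet (G T : SimpleGraph V) (u v : V) : Set (V × V) :=
  {p | G.Adj p.1 p.2 ∧ s(p.1, p.2) ≠ s(u, v) ∧
        p.1 ∈ sideOf T u v u ∧ p.2 ∈ sideOf T u v v}

/-- `φ_w(g, g') = d_T(w, a) + d_T(b, b') + d_T(a', w)` for `g = (a, b)` and `g' = (a', b')`. -/
noncomputable def phi (T : SimpleGraph V) (w : V) (g g' : V × V) : ℕ :=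
  T.dist w g.1 + T.dist g.2 g'.2 + T.dist g'.1 w

/-- For an edge `e' = (x, z)` of the subtree `T_X` of `T` induced by the vertex set `X`,
`Uside T X x z` is the set `U(e', x)`: the vertices of `X` lying in the connected component
of `x` of `T_X - e'` (equivalently, of `T` minus the edge `s(x, z)`).  The set `U(e', z)`
is `Uside T X z x`. -/
def Uside (T : SimpleGraph V) (X : Set V) (x z : V) : Set V :=
  {t ∈ X | (T.deleteEdges {s(x, z)}).Reachable x t}

/-- Deleting an edge `s(x, y)` from a connected graph leaves every vertex reachable from `x` or
from `y`. -/
theorem SimpleGraph.Connected.reachable_deleteEdges_or {V : Type*} {T : SimpleGraph V}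
    (hT : T.Connected) (x y t : V) :
    (T.deleteEdges {s(x, y)}).Reachable x t ∨ (T.deleteEdges {s(x, y)}).Reachable y t := by
  suffices ∀ (w : V), T.Walk t w → w = x → (T.deleteEdges {s(x, y)}).Reachable x t ∨
      (T.deleteEdges {s(x, y)}).Reachable y t from this x (hT t x).some rfl
  intro w p hw
  induction p with
  | nil => exact .inl (hw ▸ .rfl)
  | @cons a b c hab p ih =>
    by_cases heq : s(b, a) = s(x, y)
    · rcases Sym2.eq_iff.mp heq with ⟨-, rfl⟩ | ⟨-, rfl⟩
      · exact .inr .rfl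
      · exact .inl .rfl
    · have hba : (T.deleteEdges {s(x, y)}).Reachable b a :=
        Adj.reachable (by simpa [deleteEdges_adj, hab.symm] using heq)
      exact (ih hw).imp (·.trans hba) (·.trans hba)

/-- In a tree, a path realizes the distance between its endpoints. -/
theorem SimpleGraph.IsTree.dist_eq_length_of_isPath {V : Type*} {T : SimpleGraph V}
    (hT : T.IsTree) {a b : V} {p : T.Walk a b} (hp : p.IsPath) : T.dist a b = p.length := by
  obtain ⟨q, hq, hlen⟩ := hT.connected.exists_path_of_dist a b
  rw [← hlen, (hT.existsUnique_path a b).unique hq hp]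

/-- In a tree, a vertex on the `x`-side of the edge `s(x, y)` is one step farther from `y`
than from `x`. -/
theorem SimpleGraph.IsTree.dist_eq_dist_add_one_of_reachable_deleteEdges {V : Type*}
    {T : SimpleGraph V} (hT : T.IsTree) {x y t : V} (hxy : T.Adj x y)
    (ht : (T.deleteEdges {s(x, y)}).Reachable x t) : T.dist y t = T.dist x t + 1 := by
  classical
  obtain ⟨p, hp⟩ := ht.exists_isPath
  have hy : y ∉ p.support := fun h ↦
    isAcyclic_iff_forall_adj_isBridge.mp hT.isAcyclic hxy (p.takeUntil y h).reachable
  have hle : T.deleteEdges {s(x, y)} ≤ T := deleteEdges_le _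
  have hq : (p.mapLe hle).IsPath := hp.mapLe hle
  have hc : (Walk.cons hxy.symm (p.mapLe hle)).IsPath := by
    rw [Walk.cons_isPath_iff]
    exact ⟨hq, by simpa using hy⟩
  rw [hT.dist_eq_length_of_isPath hc, hT.dist_eq_length_of_isPath hq, Walk.length_cons]

/-- If `e'' = (x', y)` is an edge of `T_X` with `φ_y(g_{x'}, g'_{x'}) < φ_y(g_y, g'_y)` and
`{a_{x'}, a'_{x'}} ∩ U(e'', x') ≠ ∅`, then `a_y, a'_y ∈ U(e'', x')` and
`{a_{x'}, a'_{x'}} ∩ U(e'', y) ≠ ∅`. -/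
theorem second_edge_case
    (G T : SimpleGraph V) (hTG : T ≤ G) (hT : T.IsTree)
    (hGconn : G.Connected) (h2ec : ∀ f ∈ G.edgeSet, (G.deleteEdges {f}).Connected)
    (u v : V) (he : T.Adj u v)
    (gp : V → (V × V) × (V × V))
    (hgp : ∀ w ∈ sideOf T u v u,
      (gp w).1 ∈ swapSet G T u v ∧ (gp w).2 ∈ swapSet G T u v ∧
        ∀ g ∈ swapSet G T u v, ∀ g' ∈ swapSet G T u v,
          phi T w g g' ≤ phi T w (gp w).1 (gp w).2)
    (x' y : V) (hx' : x' ∈ sideOf T u v u) (hy : y ∈ sideOf T u v u) (hxy : T.Adj x' y)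
    (hlt : phi T y (gp x').1 (gp x').2 < phi T y (gp y).1 (gp y).2)
    (hside : (gp x').1.1 ∈ Uside T (sideOf T u v u) x' y ∨
      (gp x').2.1 ∈ Uside T (sideOf T u v u) x' y) :
    (gp y).1.1 ∈ Uside T (sideOf T u v u) x' y ∧
      (gp y).2.1 ∈ Uside T (sideOf T u v u) x' y ∧
      ((gp x').1.1 ∈ Uside T (sideOf T u v u) y x' ∨
        (gp x').2.1 ∈ Uside T (sideOf T u v u) y x') := by
  set X := sideOf T u v u
  obtain ⟨h1, h2, -⟩ := hgp y hy
  obtain ⟨h3, h4, hmax⟩ := hgp x' hx'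
  have hle := hmax _ h1 _ h2
  have key : ∀ t ∈ X, (t ∈ Uside T X x' y ∧ T.dist y t = T.dist x' t + 1) ∨
      (t ∈ Uside T X y x' ∧ T.dist x' t = T.dist y t + 1) := fun t ht ↦ by
    rcases hT.connected.reachable_deleteEdges_or x' y t with h | h
    · exact .inl ⟨⟨ht, h⟩, hT.dist_eq_dist_add_one_of_reachable_deleteEdges hxy h⟩
    · rw [Sym2.eq_swap] at h
      exact .inr ⟨⟨ht, h⟩, hT.dist_eq_dist_add_one_of_reachable_deleteEdges hxy.symm h⟩
  have hside' : T.dist y (gp x').1.1 = T.dist x' (gp x').1.1 + 1 ∨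
      T.dist y (gp x').2.1 = T.dist x' (gp x').2.1 + 1 :=
    hside.imp (fun h ↦ hT.dist_eq_dist_add_one_of_reachable_deleteEdges hxy h.2)
      (fun h ↦ hT.dist_eq_dist_add_one_of_reachable_deleteEdges hxy h.2)
  simp only [phi, T.dist_comm (u := (gp x').2.1), T.dist_comm (u := (gp y).2.1)] at hle hlt
  rcases key _ h1.2.2.1 with ⟨k1, e1⟩ | ⟨k1, e1⟩ <;>
  rcases key _ h2.2.2.1 with ⟨k2, e2⟩ | ⟨k2, e2⟩ <;>
  rcases key _ h3.2.2.1 with ⟨k3, e3⟩ | ⟨k3, e3⟩ <;>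
  rcases key _ h4.2.2.1 with ⟨k4, e4⟩ | ⟨k4, e4⟩ <;>
  first
  | exact ⟨k1, k2, .inl k3⟩
  | exact ⟨k1, k2, .inr k4⟩
  | (exfalso; omega)
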